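/- Let t₀ and t₁ be total enumeration degrees and let a be an enumeration degree with a > t₀ and a > t₁. If {a, b} is a nontrivial K_{t₀}-pair and {a, c} is a nontrivial K_{t₁}-pair, then t₀ = t₁. In particular, {a, b ∨ c} is a nontrivial K_{t₀}-pair. -/

import Mathlib

open Classical

/-- The `e`-th computably enumerable subset of `ℕ` (the domain of the `e`-th
partial computable function). -/
def ceSet (e : ℕ) : Set ℕ :=
  {n | ((Denumerable.ofNat Nat.Partrec.Code e).eval n).Dom}

/-- The finite set canonically coded by `u` (via binary expansion). -/
def finCode (u : ℕ) : Set ℕ := {n | Nat.testBit u n}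

/-- The `i`-th enumeration operator applied to `B`. -/
def eOp (i : ℕ) (B : Set ℕ) : Set ℕ :=
  {n | ∃ u : ℕ, Nat.pair n u ∈ ceSet i ∧ finCode u ⊆ B}

/-- `A ≤ₑ B` via the index `i`. -/
def ELeVia (A B : Set ℕ) (i : ℕ) : Prop := A = eOp i B

/-- Enumeration reducibility. -/
def ELe (A B : Set ℕ) : Prop := ∃ i, ELeVia A B i

/-- `A ≡ₑ B` via the pair of indices `⟨i,j⟩`. -/
def EEquivVia (A B : Set ℕ) (i j : ℕ) : Prop := ELeVia A B i ∧ ELeVia B A j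

/-- Enumeration equivalence. -/
def EEquiv (A B : Set ℕ) : Prop := ELe A B ∧ ELe B A

/-- Strict enumeration reducibility. -/
def ELt (A B : Set ℕ) : Prop := ELe A B ∧ ¬ ELe B A

/-- The enumeration degree of `A`, i.e. its `≡ₑ`-class. -/
def edeg (A : Set ℕ) : Set (Set ℕ) := {B | EEquiv A B}

/-- `K_A = {⟨i,n⟩ : n ∈ Γ_i(A)}`. -/
def KSet (A : Set ℕ) : Set ℕ := {m | m.unpair.2 ∈ eOp m.unpair.1 A}

/-- The skip `A^⋄ = ℕ \ K_A`. -/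
def eSkip (A : Set ℕ) : Set ℕ := (KSet A)ᶜ

/-- `A ⊕ B = {2n : n ∈ A} ∪ {2n+1 : n ∈ B}`. -/
def eJoin (A B : Set ℕ) : Set ℕ :=
  {n | (∃ m ∈ A, n = 2 * m) ∨ (∃ m ∈ B, n = 2 * m + 1)}

/-- The enumeration jump `A' = K_A ⊕ (ℕ \ K_A)`. -/
def eJump (A : Set ℕ) : Set ℕ := eJoin (KSet A) (KSet A)ᶜ

/-- `u` is a uniformity function for `f` on the domain `D`. -/
def IsUniformityOn (D : Set (Set ℕ)) (f : Set ℕ → Set ℕ) (u : ℕ → ℕ) : Prop :=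
  ∀ A ∈ D, ∀ B ∈ D, ∀ i j : ℕ, EEquivVia A B i j →
    EEquivVia (f A) (f B) (u (Nat.pair i j)).unpair.1 (u (Nat.pair i j)).unpair.2

/-- `f` is uniformly e-invariant on the domain `D`. -/
def UniformlyEInvariantOn (D : Set (Set ℕ)) (f : Set ℕ → Set ℕ) : Prop :=
  ∃ u : ℕ → ℕ, IsUniformityOn D f u

/-- `f` is uniformly e-invariant. -/
def UniformlyEInvariant (f : Set ℕ → Set ℕ) : Prop :=
  UniformlyEInvariantOn Set.univ f

/-- `f` is e-invariant. -/
def EInvariant (f : Set ℕ → Set ℕ) : Prop :=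
  ∀ A B : Set ℕ, EEquiv A B → EEquiv (f A) (f B)

/-- `f ≤ₑ^▽ g`: `f` is e-below `g` on a cone. -/
def ConeLe (f g : Set ℕ → Set ℕ) : Prop :=
  ∃ D : Set ℕ, ∀ X : Set ℕ, ELe D X → ELe (f X) (g X)

/-- Borel functions on Cantor space `P(ℕ)`. -/
def BorelFun (F : Set ℕ → Set ℕ) : Prop := Measurable F

/-- `{A, B}` is a `K_U`-pair: there is `W ≤ₑ U` with `A × B ⊆ W` and
`Aᶜ × Bᶜ ⊆ Wᶜ` (under the standard pairing). -/
def KPair (U A B : Set ℕ) : Prop :=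
  ∃ W : Set ℕ, ELe W U ∧
    (∀ a ∈ A, ∀ b ∈ B, Nat.pair a b ∈ W) ∧
    (∀ a ∉ A, ∀ b ∉ B, Nat.pair a b ∉ W)

/-- The `K_U`-pair `{A, B}` is nontrivial: `A ≰ₑ U` and `B ≰ₑ U`. -/
def NontrivialKPair (U A B : Set ℕ) : Prop :=
  KPair U A B ∧ ¬ ELe A U ∧ ¬ ELe B U

/-- A set is total if its complement enumeration-reduces to it. -/
def TotalSet (A : Set ℕ) : Prop := ELe Aᶜ A

/-- `P` is enumerable relative to (positive information about) `B`. -/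
def EE {α : Type} [Primcodable α] (B : Set ℕ) (P : α → Prop) : Prop :=
  ∃ R : α × (ℕ × ℕ) → Prop, PrimrecPred R ∧
    ∀ a, P a ↔ ∃ w : ℕ × ℕ, R (a, w) ∧ finCode w.1 ⊆ B

theorem prim_testBit : PrimrecRel (fun u n : ℕ => n ∈ finCode u) := by
  have hpow : Primrec₂ (fun m n : ℕ => m ^ n) := Primrec₂.unpaired'.1 Nat.Primrec.pow
  have h : PrimrecPred (fun p : ℕ × ℕ => (p.1 / 2 ^ p.2) % 2 = 1) :=
    Primrec.eq.comp (Primrec.nat_mod.comp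
      (Primrec.nat_div.comp Primrec.fst (hpow.comp (Primrec.const 2) Primrec.snd))
      (Primrec.const 2)) (Primrec.const 1)
  refine PrimrecPred.of_eq h ?_
  intro p
  simp [finCode, Nat.testBit_eq_decide_div_mod_eq]

theorem lt_of_mem_finCode {u n : ℕ} (h : n ∈ finCode u) : n < u :=
  Nat.lt_of_lt_of_le Nat.lt_two_pow_self (Nat.ge_two_pow_of_testBit h)

theorem pr_forall_lt {β : Type} [Primcodable β] {R : ℕ → β → Prop} (hf : PrimrecRel R)
    {n : β → ℕ} (hn : Primrec n) : PrimrecPred (fun b => ∀ x < n b, R x b) :=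
  (hf.forall_mem_list.comp (Primrec.list_range.comp hn) Primrec.id).of_eq (by simp)

theorem pr_exists_lt {β : Type} [Primcodable β] {R : ℕ → β → Prop} (hf : PrimrecRel R)
    {n : β → ℕ} (hn : Primrec n) : PrimrecPred (fun b => ∃ x < n b, R x b) :=
  (hf.exists_mem_list.comp (Primrec.list_range.comp hn) Primrec.id).of_eq (by simp)

theorem prim_subset : PrimrecRel (fun u v : ℕ => finCode u ⊆ finCode v) := by
  have h1 : PrimrecRel (fun (x : ℕ) (p : ℕ × ℕ) => x ∈ finCode p.1 → x ∈ finCode p.2) := by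
    have a1 : PrimrecPred (fun q : ℕ × (ℕ × ℕ) => q.1 ∈ finCode q.2.1) :=
      prim_testBit.comp (Primrec.fst.comp Primrec.snd) Primrec.fst
    have a2 : PrimrecPred (fun q : ℕ × (ℕ × ℕ) => q.1 ∈ finCode q.2.2) :=
      prim_testBit.comp (Primrec.snd.comp Primrec.snd) Primrec.fst
    exact PrimrecPred.of_eq (a1.not.or a2) (fun q => by tauto)
  have h3 : PrimrecPred (fun p : ℕ × ℕ => ∀ x < p.1, x ∈ finCode p.1 → x ∈ finCode p.2) :=
    pr_forall_lt h1 Primrec.fst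
  refine PrimrecPred.of_eq h3 ?_
  intro p
  constructor
  · intro h x hx
    exact h x (lt_of_mem_finCode hx) hx
  · intro h x _ hx
    exact h hx

theorem finCode_zero : finCode 0 = ∅ := by
  ext x; simp [finCode]

theorem finCode_or (u v : ℕ) : finCode (u ||| v) = finCode u ∪ finCode v := by
  ext x; simp [finCode]

theorem finCode_two_pow (n : ℕ) : finCode (2 ^ n) = {n} := by
  ext x; simp [finCode, Nat.testBit_two_pow, eq_comm]

section closure
variable {α β : Type} [Primcodable α] [Primcodable β] {B C : Set ℕ}

theorem EE.of_iff {P Q : α → Prop} (h : EE B P) (H : ∀ a, P a ↔ Q a) : EE B Q := by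
  have : P = Q := funext fun a => propext (H a)
  exact this ▸ h

theorem EE.prim {P : α → Prop} (h : PrimrecPred P) : EE B P := by
  refine ⟨fun q => P q.1, h.comp Primrec.fst, fun a => ⟨fun h => ⟨(0, 0), h, ?_⟩, ?_⟩⟩
  · simp [finCode_zero]
  · rintro ⟨_, h, _⟩; exact h

theorem EE.mem {g : α → ℕ} (hg : Primrec g) : EE B (fun a => g a ∈ B) := by
  refine ⟨fun q => g q.1 ∈ finCode q.2.1,
    prim_testBit.comp (Primrec.fst.comp Primrec.snd) (hg.comp Primrec.fst), fun a => ⟨?_, ?_⟩⟩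
  · intro h
    exact ⟨(2 ^ g a, 0), by simp [finCode_two_pow], by simpa [finCode_two_pow] using h⟩
  · rintro ⟨w, h1, h2⟩; exact h2 h1

theorem EE.comp {P : β → Prop} {g : α → β} (h : EE B P) (hg : Primrec g) :
    EE B (fun a => P (g a)) := by
  obtain ⟨R, hR, H⟩ := h
  exact ⟨fun q => R (g q.1, q.2),
    hR.comp (Primrec.pair (hg.comp Primrec.fst) Primrec.snd), fun a => H (g a)⟩

theorem EE.or {P Q : α → Prop} (hP : EE B P) (hQ : EE B Q) : EE B (fun a => P a ∨ Q a) := by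
  obtain ⟨R, hR, H⟩ := hP
  obtain ⟨S, hS, H'⟩ := hQ
  refine ⟨fun q => R q ∨ S q, hR.or hS, fun a => ?_⟩
  beta_reduce
  rw [H, H', ← exists_or]
  apply exists_congr
  intro w
  tauto

theorem EE.ex {P : α × ℕ → Prop} (hP : EE B P) : EE B (fun a => ∃ x, P (a, x)) := by
  obtain ⟨R, hR, H⟩ := hP
  refine ⟨fun q => R ((q.1, q.2.2.unpair.1), (q.2.1, q.2.2.unpair.2)), ?_, fun a => ⟨?_, ?_⟩⟩
  · have h2 : Primrec (fun q : α × (ℕ × ℕ) => q.2.2.unpair) :=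
      Primrec.unpair.comp (Primrec.snd.comp Primrec.snd)
    exact hR.comp (Primrec.pair (Primrec.pair Primrec.fst (Primrec.fst.comp h2))
      (Primrec.pair (Primrec.fst.comp Primrec.snd) (Primrec.snd.comp h2)))
  · rintro ⟨x, hx⟩
    obtain ⟨w, h1, h2⟩ := (H _).1 hx
    exact ⟨(w.1, Nat.pair x w.2), by simpa using h1, h2⟩
  · rintro ⟨w, h1, h2⟩
    exact ⟨w.2.unpair.1, (H _).2 ⟨_, h1, h2⟩⟩

theorem EE.ball {P : α × ℕ → Prop} (hP : EE B P) {n : α → ℕ} (hn : Primrec n) :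
    EE B (fun a => ∀ x < n a, P (a, x)) := by
  obtain ⟨R, hR, H⟩ := hP
  refine ⟨fun q => ∀ x < n q.1, ∃ w < q.2.2, R ((q.1, x), w.unpair) ∧
    finCode w.unpair.1 ⊆ finCode q.2.1, ?_, fun a => ⟨?_, ?_⟩⟩
  · have h1 : PrimrecRel (fun (w : ℕ) (q : ℕ × (α × (ℕ × ℕ))) => R ((q.2.1, q.1), w.unpair) ∧
        finCode w.unpair.1 ⊆ finCode q.2.2.1) := by
      have hw : Primrec (fun r : ℕ × (ℕ × (α × (ℕ × ℕ))) => r.1.unpair) :=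
        Primrec.unpair.comp Primrec.fst
      have hq : Primrec (fun r : ℕ × (ℕ × (α × (ℕ × ℕ))) => r.2.2) :=
        Primrec.snd.comp Primrec.snd
      have b1 : PrimrecPred (fun r : ℕ × (ℕ × (α × (ℕ × ℕ))) =>
          R ((r.2.2.1, r.2.1), r.1.unpair)) :=
        hR.comp (Primrec.pair (Primrec.pair (Primrec.fst.comp hq)
          (Primrec.fst.comp Primrec.snd)) hw)
      have b2 : PrimrecPred (fun r : ℕ × (ℕ × (α × (ℕ × ℕ))) =>
          finCode r.1.unpair.1 ⊆ finCode r.2.2.2.1) :=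
        prim_subset.comp (Primrec.fst.comp hw) (Primrec.fst.comp (Primrec.snd.comp hq))
      exact b1.and b2
    have h2 : PrimrecRel (fun (x : ℕ) (q : α × (ℕ × ℕ)) => ∃ w < q.2.2,
        R ((q.1, x), w.unpair) ∧ finCode w.unpair.1 ⊆ finCode q.2.1) :=
      pr_exists_lt h1 (Primrec.snd.comp (Primrec.snd.comp Primrec.snd))
    exact pr_forall_lt h2 (hn.comp Primrec.fst)
  · intro h
    have key : ∀ m, (∀ x < m, P (a, x)) → ∃ U K : ℕ, finCode U ⊆ B ∧ ∀ x < m, ∃ w < K,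
        R ((a, x), w.unpair) ∧ finCode w.unpair.1 ⊆ finCode U := by
      intro m
      induction m with
      | zero => intro _; exact ⟨0, 0, by simp [finCode_zero], by simp⟩
      | succ m ih =>
        intro h
        obtain ⟨U, K, hU, hK⟩ := ih (fun x hx => h x (by omega))
        obtain ⟨w, hw1, hw2⟩ := (H _).1 (h m (by omega))
        refine ⟨U ||| w.1, K + Nat.pair w.1 w.2 + 1, ?_, ?_⟩
        · rw [finCode_or]; exact Set.union_subset hU hw2
        · intro x hx
          rw [finCode_or]
          rcases Nat.lt_succ_iff_lt_or_eq.1 hx with hx | rfl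
          · obtain ⟨v, hv, h1, h2⟩ := hK x hx
            exact ⟨v, by omega, h1, h2.trans Set.subset_union_left⟩
          · exact ⟨Nat.pair w.1 w.2, by omega, by simpa using hw1, by simp⟩
    obtain ⟨U, K, h1, h2⟩ := key (n a) h
    exact ⟨(U, K), h2, h1⟩
  · rintro ⟨w, h1, h2⟩ x hx
    obtain ⟨v, _, h3, h4⟩ := h1 x hx
    exact (H _).2 ⟨_, h3, h4.trans h2⟩

theorem EE.and {P Q : α → Prop} (hP : EE B P) (hQ : EE B Q) : EE B (fun a => P a ∧ Q a) := by
  have e0 : PrimrecPred (fun q : α × ℕ => q.2 = 0) :=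
    Primrec.eq.comp Primrec.snd (Primrec.const 0)
  have h : EE B (fun q : α × ℕ => (q.2 = 0 ∨ P q.1) ∧ (¬ q.2 = 0 ∨ Q q.1)) := by
    have h1 : EE B (fun q : α × ℕ => (q.2 = 0 ∧ Q q.1) ∨ (¬ q.2 = 0 ∧ P q.1)) := by
      apply EE.or
      · obtain ⟨R, hR, H⟩ := hQ
        refine ⟨fun q => q.1.2 = 0 ∧ R (q.1.1, q.2), (e0.comp Primrec.fst).and (hR.comp
          (Primrec.pair (Primrec.fst.comp Primrec.fst) Primrec.snd)), fun a => ?_⟩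
        beta_reduce
        rw [H]
        constructor
        · rintro ⟨h, w, h1, h2⟩; exact ⟨w, ⟨h, h1⟩, h2⟩
        · rintro ⟨w, ⟨h, h1⟩, h2⟩; exact ⟨h, w, h1, h2⟩
      · obtain ⟨R, hR, H⟩ := hP
        refine ⟨fun q => ¬ q.1.2 = 0 ∧ R (q.1.1, q.2), (e0.comp Primrec.fst).not.and (hR.comp
          (Primrec.pair (Primrec.fst.comp Primrec.fst) Primrec.snd)), fun a => ?_⟩
        beta_reduce
        rw [H]
        constructor
        · rintro ⟨h, w, h1, h2⟩; exact ⟨w, ⟨h, h1⟩, h2⟩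
        · rintro ⟨w, ⟨h, h1⟩, h2⟩; exact ⟨h, w, h1, h2⟩
    exact h1.of_iff (fun q => by tauto)
  refine (h.ball (Primrec.const 2)).of_iff (fun a => ⟨fun h => ?_, ?_⟩)
  · have h0 := h 0 (by norm_num)
    have h1 := h 1 (by norm_num)
    simp at h0 h1
    exact ⟨h1, h0⟩
  · rintro ⟨h1, h2⟩ x _
    exact ⟨Or.inr h1, Or.inr h2⟩

/-- Substituting an enumeration of `B` from `C`. -/
theorem EE.trans {P : α → Prop} (hP : EE B P) (hB : EE C (fun n : ℕ => n ∈ B)) : EE C P := by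
  obtain ⟨R, hR, H⟩ := hP
  have h1 : EE C (fun q : ((α × ℕ) × ℕ) => R (q.1.1, (q.1.2, q.2)) ∧
      ∀ x < q.1.2, x ∉ finCode q.1.2 ∨ x ∈ B) := by
    apply EE.and
    · exact EE.prim (hR.comp (Primrec.pair (Primrec.fst.comp Primrec.fst)
        (Primrec.pair (Primrec.snd.comp Primrec.fst) Primrec.snd)))
    · have : EE C (fun r : (((α × ℕ) × ℕ) × ℕ) => r.2 ∉ finCode r.1.1.2 ∨ r.2 ∈ B) := by
        apply EE.or
        · exact EE.prim (PrimrecPred.not (prim_testBit.comp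
            (Primrec.snd.comp (Primrec.fst.comp Primrec.fst)) Primrec.snd))
        · exact hB.comp Primrec.snd
      exact this.ball (Primrec.snd.comp Primrec.fst)
  refine h1.ex.ex.of_iff (fun a => ?_)
  rw [H]
  constructor
  · rintro ⟨u, k, h1, h2⟩
    exact ⟨(u, k), h1, fun x hx => (h2 x (lt_of_mem_finCode hx)).resolve_left (fun h => h hx)⟩
  · rintro ⟨⟨u, k⟩, h1, h2⟩
    refine ⟨u, k, h1, fun x _ => ?_⟩
    by_cases hx : x ∈ finCode u
    · exact Or.inr (h2 hx)
    · exact Or.inl hx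

end closure

theorem ee_ceSet (B : Set ℕ) (i : ℕ) : EE B (fun n => n ∈ ceSet i) := by
  let c := Denumerable.ofNat Nat.Partrec.Code i
  have h : PrimrecPred (fun q : ℕ × ℕ => (Nat.Partrec.Code.evaln q.2 c q.1).isSome = true) := by
    have h1 : Primrec (fun q : ℕ × ℕ => Nat.Partrec.Code.evaln q.2 c q.1) :=
      Nat.Partrec.Code.primrec_evaln.comp
        (Primrec.pair (Primrec.pair Primrec.snd (Primrec.const c)) Primrec.fst)
    exact Primrec.eq.comp (Primrec.option_isSome.comp h1) (Primrec.const true)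
  refine (EE.prim h).ex.of_iff (fun n => ?_)
  simp only [ceSet, Set.mem_ofPred_eq, Part.dom_iff_mem, Nat.Partrec.Code.evaln_complete,
    Option.isSome_iff_exists, Option.mem_def]
  exact exists_comm

theorem ele_iff {A B : Set ℕ} : ELe A B ↔ EE B (fun n => n ∈ A) := by
  constructor
  · rintro ⟨i, rfl⟩
    have h1 : EE B (fun q : ℕ × ℕ => Nat.pair q.1 q.2 ∈ ceSet i ∧
        ∀ x < q.2, x ∉ finCode q.2 ∨ x ∈ B) := by
      apply EE.and
      · exact (ee_ceSet B i).comp (Primrec₂.natPair.comp Primrec.fst Primrec.snd)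
      · have : EE B (fun r : ((ℕ × ℕ) × ℕ) => r.2 ∉ finCode r.1.2 ∨ r.2 ∈ B) := by
          apply EE.or
          · exact EE.prim (PrimrecPred.not (prim_testBit.comp
              (Primrec.snd.comp Primrec.fst) Primrec.snd))
          · exact EE.mem Primrec.snd
        exact this.ball Primrec.snd
    refine h1.ex.of_iff (fun n => ?_)
    apply exists_congr
    intro u
    constructor
    · rintro ⟨h1, h2⟩
      exact ⟨h1, fun x hx => (h2 x (lt_of_mem_finCode hx)).resolve_left (fun h => h hx)⟩
    · rintro ⟨h1, h2⟩
      refine ⟨h1, fun x _ => ?_⟩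
      by_cases hx : x ∈ finCode u
      · exact Or.inr (h2 hx)
      · exact Or.inl hx
  · rintro ⟨R, ⟨hd, hR⟩, H⟩
    have hf : Computable₂ (fun (p k : ℕ) => decide (R (p.unpair.1, (p.unpair.2, k)))) := by
      have hu : Primrec (fun q : ℕ × ℕ => q.1.unpair) := Primrec.unpair.comp Primrec.fst
      have : Primrec (fun q : ℕ × ℕ => decide (R (q.1.unpair.1, (q.1.unpair.2, q.2)))) := by
        refine (hR.comp (Primrec.pair (Primrec.fst.comp hu)
          (Primrec.pair (Primrec.snd.comp hu) Primrec.snd))).of_eq (fun q => ?_)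
        simp
      exact this.to_comp
    have hp : Partrec (fun p : ℕ =>
        Nat.rfind (fun k => Part.some (decide (R (p.unpair.1, (p.unpair.2, k)))))) :=
      Partrec.rfind hf.partrec₂
    obtain ⟨c, hc⟩ := Nat.Partrec.Code.exists_code.1 (Partrec.nat_iff.1 hp)
    refine ⟨Encodable.encode c, ?_⟩
    unfold ELeVia
    ext n
    refine (H n).trans ?_
    have key : ∀ u, Nat.pair n u ∈ ceSet (Encodable.encode c) ↔ ∃ k, R (n, (u, k)) := by
      intro u
      simp only [ceSet, Set.mem_ofPred_eq, Denumerable.ofNat_encode, hc]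
      refine Nat.rfind_dom'.trans ?_
      simp only [Nat.unpair_pair, Part.mem_some_iff, Part.some_dom]
      simp
    simp only [eOp, Set.mem_ofPred_eq, key]
    constructor
    · rintro ⟨⟨u, k⟩, h1, h2⟩; exact ⟨u, ⟨k, h1⟩, h2⟩
    · rintro ⟨u, ⟨k, h1⟩, h2⟩; exact ⟨(u, k), h1, h2⟩

theorem ELe.trans' {A B C : Set ℕ} (h1 : ELe A B) (h2 : ELe B C) : ELe A C :=
  ele_iff.2 ((ele_iff.1 h1).trans (ele_iff.1 h2))

/-- K-pairs are closed downward in the first coordinate. -/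
theorem KPair.down {U A B X : Set ℕ} (h : KPair U A B) (hX : ELe X A) : KPair U X B := by
  obtain ⟨W, hW, h1, h2⟩ := h
  obtain ⟨R, hR, H⟩ := ele_iff.1 hX
  refine ⟨{p | ∃ u k, R (p.unpair.1, (u, k)) ∧
    ∀ x < u, x ∉ finCode u ∨ Nat.pair x p.unpair.2 ∈ W}, ?_, ?_, ?_⟩
  · refine ELe.trans' (ele_iff.2 ?_) hW
    have e1 : EE W (fun q : (ℕ × ℕ) × ℕ => R (q.1.1.unpair.1, (q.1.2, q.2)) ∧
        ∀ x < q.1.2, x ∉ finCode q.1.2 ∨ Nat.pair x q.1.1.unpair.2 ∈ W) := by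
      apply EE.and
      · exact EE.prim (hR.comp (Primrec.pair
          (Primrec.fst.comp (Primrec.unpair.comp (Primrec.fst.comp Primrec.fst)))
          (Primrec.pair (Primrec.snd.comp Primrec.fst) Primrec.snd)))
      · have : EE W (fun r : (((ℕ × ℕ) × ℕ) × ℕ) => r.2 ∉ finCode r.1.1.2 ∨
            Nat.pair r.2 r.1.1.1.unpair.2 ∈ W) := by
          apply EE.or
          · exact EE.prim (PrimrecPred.not (prim_testBit.comp
              (Primrec.snd.comp (Primrec.fst.comp Primrec.fst)) Primrec.snd))
          · exact EE.mem (Primrec₂.natPair.comp Primrec.snd (Primrec.snd.comp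
              (Primrec.unpair.comp (Primrec.fst.comp (Primrec.fst.comp Primrec.fst)))))
        exact this.ball (Primrec.snd.comp Primrec.fst)
    exact e1.ex.ex
  · intro a ha b hb
    obtain ⟨w, h3, h4⟩ := (H a).1 ha
    refine ⟨w.1, w.2, by simpa using h3, fun x _ => ?_⟩
    by_cases hx : x ∈ finCode w.1
    · right; simpa using h1 x (h4 hx) b hb
    · exact Or.inl hx
  · rintro a ha b hb ⟨u, k, h3, h4⟩
    simp only [Nat.unpair_pair] at h3 h4
    apply ha
    refine (H a).2 ⟨(u, k), h3, fun x hx => ?_⟩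
    by_contra hxA
    exact h2 x hxA b hb ((h4 x (lt_of_mem_finCode hx)).resolve_left (fun h => h hx))

/-- A total set below one side of a nontrivial K-pair is below the base. -/
theorem total_le_base {U A B T : Set ℕ} (h : KPair U A B) (hB : ¬ ELe B U)
    (hT : TotalSet T) (hTA : ELe T A) : ELe T U := by
  obtain ⟨V, hV, v1, v2⟩ := h.down hTA
  obtain ⟨V', hV', v1', v2'⟩ := h.down (ELe.trans' hT hTA)
  by_contra hTU
  apply hB
  rw [ele_iff] at hV hV' hTU ⊢
  have e1 : EE U (fun q : ℕ × ℕ => Nat.pair q.2 q.1 ∈ V ∧ Nat.pair q.2 q.1 ∈ V') := by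
    have hp : Primrec (fun q : ℕ × ℕ => Nat.pair q.2 q.1) :=
      Primrec₂.natPair.comp Primrec.snd Primrec.fst
    exact (hV.comp hp).and (hV'.comp hp)
  refine e1.ex.of_iff (fun b => ⟨?_, fun hb => ?_⟩)
  · rintro ⟨x, h1, h2⟩
    by_contra hb
    by_cases hx : x ∈ T
    · exact v2' x (fun h => h hx) b hb h2
    · exact v2 x hx b hb h1
  · by_contra hne
    apply hTU
    have hp : Primrec (fun x : ℕ => Nat.pair x b) :=
      Primrec₂.natPair.comp Primrec.id (Primrec.const b)
    refine (hV.comp hp).of_iff (fun x => ⟨fun hx => ?_, fun hx => v1 x hx b hb⟩)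
    by_contra hxT
    exact hne ⟨x, hx, v1' x hxT b hb⟩

/-- K-pairs are closed under joins in the second coordinate. -/
theorem KPair.join {U A B C : Set ℕ} (h : KPair U A B) (h' : KPair U A C) :
    KPair U A (eJoin B C) := by
  obtain ⟨V, hV, v1, v2⟩ := h
  obtain ⟨W, hW, w1, w2⟩ := h'
  refine ⟨{p | (p.unpair.2 % 2 = 0 ∧ Nat.pair p.unpair.1 (p.unpair.2 / 2) ∈ V) ∨
    (p.unpair.2 % 2 = 1 ∧ Nat.pair p.unpair.1 (p.unpair.2 / 2) ∈ W)}, ?_, ?_, ?_⟩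
  · rw [ele_iff] at hV hW ⊢
    have hp : Primrec (fun p : ℕ => Nat.pair p.unpair.1 (p.unpair.2 / 2)) :=
      Primrec₂.natPair.comp (Primrec.fst.comp Primrec.unpair)
        (Primrec.nat_div.comp (Primrec.snd.comp Primrec.unpair) (Primrec.const 2))
    have hm : ∀ c, PrimrecPred (fun p : ℕ => p.unpair.2 % 2 = c) := fun c =>
      Primrec.eq.comp (Primrec.nat_mod.comp (Primrec.snd.comp Primrec.unpair)
        (Primrec.const 2)) (Primrec.const c)
    exact ((EE.prim (hm 0)).and (hV.comp hp)).or ((EE.prim (hm 1)).and (hW.comp hp))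
  · rintro a ha b (⟨m, hm, rfl⟩ | ⟨m, hm, rfl⟩)
    · left; simpa using v1 a ha m hm
    · right
      have e1 : (2 * m + 1) % 2 = 1 := by omega
      have e2 : (2 * m + 1) / 2 = m := by omega
      simpa [e1, e2] using w1 a ha m hm
  · intro a ha b hb
    simp only [Set.mem_ofPred_eq, Nat.unpair_pair]
    rintro (⟨h0, h1⟩ | ⟨h0, h1⟩)
    · exact v2 a ha (b / 2) (fun hb' => hb (Or.inl ⟨b / 2, hb', by omega⟩)) h1
    · exact w2 a ha (b / 2) (fun hb' => hb (Or.inr ⟨b / 2, hb', by omega⟩)) h1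

theorem le_join_left (B C : Set ℕ) : ELe B (eJoin B C) := by
  rw [ele_iff]
  have hp : Primrec (fun n : ℕ => 2 * n) := Primrec.nat_mul.comp (Primrec.const 2) Primrec.id
  refine (EE.mem (B := eJoin B C) hp).of_iff (fun n => ⟨?_, fun h => Or.inl ⟨n, h, rfl⟩⟩)
  rintro (⟨m, hm, h⟩ | ⟨m, hm, h⟩)
  · have : n = m := by omega
    exact this ▸ hm
  · omega

/-- If `a > t₀, t₁` with `t₀, t₁` total degrees, `{a,b}` is a nontrivial
`K_{t₀}`-pair and `{a,c}` is a nontrivial `K_{t₁}`-pair, then `t₀ = t₁`; in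
particular `{a, b ∨ c}` is a nontrivial `K_{t₀}`-pair. -/
theorem kpair_unique_total_base (T₀ T₁ A B C : Set ℕ)
    (hT₀ : TotalSet T₀) (hT₁ : TotalSet T₁)
    (h₀ : ELt T₀ A) (h₁ : ELt T₁ A)
    (hB : NontrivialKPair T₀ A B) (hC : NontrivialKPair T₁ A C) :
    EEquiv T₀ T₁ ∧ NontrivialKPair T₀ A (eJoin B C) := by
  have h01 : ELe T₀ T₁ := total_le_base hC.1 hC.2.2 hT₀ h₀.1
  have h10 : ELe T₁ T₀ := total_le_base hB.1 hB.2.2 hT₁ h₁.1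
  refine ⟨⟨h01, h10⟩, KPair.join hB.1 ?_, hB.2.1, fun h => hB.2.2 ((le_join_left B C).trans' h)⟩
  obtain ⟨W, hW, h⟩ := hC.1
  exact ⟨W, hW.trans' h10, h⟩
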